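/- Let p, q be language models over a finite alphabet Σ such that q(y) > 0 whenever p(y) > 0, and assume KL(p‖q) < ∞. Then the KL divergence decomposes over prefixes: KL(p‖q) = ∑_{x ∈ Σ*} π_p(x) · KL( p̄(·|x) ‖ q̄(·|x) ), where the sum ranges over all strings x ∈ Σ*, terms with π_p(x) = 0 contribute 0, and each local KL is nonnegative (so the right-hand side is a well-defined sum in [0, ∞]). -/

import Mathlib

open scoped BigOperators

/-- `pr p y` is the real-valued probability mass of `y` under the PMF `p`. -/
noncomputable def pr {A : Type*} (p : PMF A) (y : A) : ℝ := (p y).toReal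

/-- The KL divergence `KL(p‖q) = ∑_y p(y)·log(p(y)/q(y))` (terms with `p(y) = 0`
contribute `0`). -/
noncomputable def KLdiv {A : Type*} (p q : PMF A) : ℝ :=
  ∑' y, pr p y * Real.log (pr p y / pr q y)

/-- Expectation of `h` under the PMF `p`. -/
noncomputable def Epf {A : Type*} (p : PMF A) (h : A → ℝ) : ℝ := ∑' y, pr p y * h y

/-- Variance of `h` under the PMF `p`. -/
noncomputable def Varp {A : Type*} (p : PMF A) (h : A → ℝ) : ℝ :=
  Epf p (fun y => h y ^ 2) - (Epf p h) ^ 2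

/-- The prefix probability `π_p(x) = ∑_z p(x ++ z)` of a language model `p`. -/
noncomputable def prefixProb {σ : Type*} (p : PMF (List σ)) (x : List σ) : ℝ :=
  ∑' z : List σ, pr p (x ++ z)

/-- The conditional next-symbol distribution `p̄(·|x)` on `Σ̄ = Σ ∪ {EOS}`
(`Option σ`, with `none` playing the role of `EOS`):
`p̄(a|x) = π_p(x ++ [a]) / π_p(x)` for `a ∈ Σ` and `p̄(EOS|x) = p(x) / π_p(x)`. -/
noncomputable def condProb {σ : Type*} (p : PMF (List σ)) (x : List σ) : Option σ → ℝ
  | some a => prefixProb p (x ++ [a]) / prefixProb p x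
  | none => pr p x / prefixProb p x

/-- The local KL divergence at a prefix `x`:
`KL(p̄(·|x) ‖ q̄(·|x)) = ∑_{a ∈ Σ̄} p̄(a|x)·log(p̄(a|x)/q̄(a|x))`. -/
noncomputable def localKL {σ : Type*} [Fintype σ] (p q : PMF (List σ)) (x : List σ) : ℝ :=
  ∑ a : Option σ, condProb p x a * Real.log (condProb p x a / condProb q x a)

open Filter Topology

/-- A list is either empty or a head together with a tail. -/
def sumProdEquivList (σ : Type*) : Unit ⊕ (σ × List σ) ≃ List σ where
  toFun
    | .inl _ => []
    | .inr (a, l) => a :: l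
  invFun
    | [] => .inl ()
    | a :: l => .inr (a, l)
  left_inv := by rintro (_ | ⟨a, l⟩) <;> rfl
  right_inv := by rintro (_ | ⟨a, l⟩) <;> rfl

/-- The sum of `g` over all extensions of the prefix `x`. -/
noncomputable def tailSum {σ : Type*} (g : List σ → ℝ) (x : List σ) : ℝ :=
  ∑' z : List σ, g (x ++ z)

theorem summable_append {σ : Type*} {g : List σ → ℝ} (hg : Summable g) (x : List σ) :
    Summable fun z => g (x ++ z) :=
  hg.comp_injective (List.append_right_injective x)

theorem tailSum_eq_add_sum {σ : Type*} [Fintype σ] {g : List σ → ℝ} (hg : Summable g)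
    (x : List σ) : tailSum g x = g x + ∑ a, tailSum g (x ++ [a]) := by
  have hcons : Summable fun y : σ × List σ => g (x ++ y.1 :: y.2) :=
    hg.comp_injective (i := fun y : σ × List σ => x ++ y.1 :: y.2) fun y z h => by
      simpa [Prod.ext_iff] using h
  have hnil : HasSum (fun _ : Unit => g (x ++ [])) (g x) := by
    simp
  have h : HasSum (fun z => g (x ++ z)) (g x + ∑' y : σ × List σ, g (x ++ y.1 :: y.2)) :=
    (sumProdEquivList σ).hasSum_iff.mp
      (HasSum.sum (f := (fun z => g (x ++ z)) ∘ sumProdEquivList σ) hnil hcons.hasSum)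
  rw [tailSum, h.tsum_eq, hcons.tsum_prod, tsum_fintype]
  simp [tailSum]

/-- The sum of `g` over all lists of length `n`. -/
noncomputable def levelSum {σ : Type*} [Fintype σ] (g : List σ → ℝ) (n : ℕ) : ℝ :=
  ∑ v : Fin n → σ, g (List.ofFn v)

theorem levelSum_succ {σ : Type*} [Fintype σ] (g : List σ → ℝ) (n : ℕ) :
    levelSum g (n + 1) = levelSum (fun x => ∑ a, g (x ++ [a])) n := by
  unfold levelSum
  rw [← (Fin.snocEquiv fun _ : Fin (n + 1) => σ).sum_comp, Fintype.sum_prod_type_right]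
  simp only [Fin.snocEquiv, List.ofFn_succ', Equiv.coe_fn_mk, Fin.snoc_castSucc, Fin.snoc_last,
    List.concat_eq_append]

theorem HasSum.levelSum {σ : Type*} [Fintype σ] {g : List σ → ℝ} {s : ℝ} (hg : HasSum g s) :
    HasSum (levelSum g) s :=
  HasSum.sigma (f := fun y : (n : ℕ) × (Fin n → σ) => g (List.ofFn y.2))
    (List.equivSigmaTuple.symm.hasSum_iff.mpr hg) fun _ => hasSum_fintype _

theorem hasSum_of_hasSum_levelSum {σ : Type*} [Fintype σ] {g : List σ → ℝ} {s : ℝ}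
    (h0 : ∀ x, 0 ≤ g x) (hg : HasSum (levelSum g) s) : HasSum g s := by
  have hs : Summable g := by
    rw [← List.equivSigmaTuple.symm.summable_iff]
    refine (summable_sigma_of_nonneg fun y => h0 _).mpr ⟨fun n => .of_finite, ?_⟩
    convert hg.summable using 2 with n
    exact tsum_fintype _
  rw [← hs.hasSum.levelSum.unique hg]
  exact hs.hasSum

/-- Telescoping over levels of the prefix tree. -/
theorem sum_levelSum_add {σ : Type*} [Fintype σ] {L E : List σ → ℝ}
    (hE : ∀ x, E x = L x + ∑ a, E (x ++ [a])) (n : ℕ) :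
    ∑ k ∈ Finset.range n, levelSum L k + levelSum E n = E [] := by
  induction n with
  | zero => simp [levelSum]
  | succ n ih =>
    rw [← ih, Finset.sum_range_succ, levelSum_succ, add_assoc, add_right_inj]
    unfold levelSum
    rw [← Finset.sum_add_distrib]
    exact Finset.sum_congr rfl fun v _ => (hE _).symm

/-- A nonnegative potential on the prefix tree which is dominated by the tail sums of a summable
function is, at the root, the sum of its local decrements. -/
theorem hasSum_of_le_tailSum {σ : Type*} [Fintype σ] {L E f : List σ → ℝ}
    (hL : ∀ x, 0 ≤ L x) (hE0 : ∀ x, 0 ≤ E x) (hf : Summable f) (hEf : ∀ x, E x ≤ tailSum f x)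
    (hE : ∀ x, E x = L x + ∑ a, E (x ++ [a])) : HasSum L (E []) := by
  have hlim : Tendsto (levelSum (tailSum f)) atTop (𝓝 0) := by
    have h := (hf.hasSum.levelSum.tendsto_sum_nat).const_sub (tailSum f [])
    have h0 : tailSum f [] - ∑' x, f x = 0 := by simp [tailSum]
    rw [h0] at h
    refine h.congr fun n => ?_
    rw [← sum_levelSum_add (tailSum_eq_add_sum hf) n, add_sub_cancel_left]
  have hElim : Tendsto (levelSum E) atTop (𝓝 0) :=
    squeeze_zero (fun n => Finset.sum_nonneg fun _ _ => hE0 _)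
      (fun n => Finset.sum_le_sum fun _ _ => hEf _) hlim
  refine hasSum_of_hasSum_levelSum hL
    ((hasSum_iff_tendsto_nat_of_nonneg (fun n => Finset.sum_nonneg fun _ _ => hL _) _).mpr ?_)
  have h := hElim.const_sub (E [])
  rw [sub_zero] at h
  refine h.congr fun n => ?_
  rw [← sum_levelSum_add hE n, add_sub_cancel_right]
  rfl

theorem sub_le_mul_log_div {a b : ℝ} (ha : 0 ≤ a) (hb : 0 ≤ b) (hab : 0 < a → 0 < b) :
    a - b ≤ a * Real.log (a / b) := by
  rcases ha.eq_or_lt with rfl | ha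
  · simpa using hb
  · have hb := hab ha
    have h := mul_le_mul_of_nonneg_left (Real.one_sub_inv_le_log_of_pos (div_pos ha hb)) ha.le
    have h' : a * (1 - (a / b)⁻¹) = a - b := by field_simp
    linarith

/-- The log-sum inequality. -/
theorem mul_log_div_le_of_hasSum {ι : Type*} {a b : ι → ℝ} {A B D : ℝ}
    (ha : ∀ i, 0 ≤ a i) (hb : ∀ i, 0 ≤ b i) (hab : ∀ i, 0 < a i → 0 < b i)
    (hA : HasSum a A) (hB : HasSum b B)
    (hD : HasSum (fun i => a i * Real.log (a i / b i)) D) :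
    A * Real.log (A / B) ≤ D := by
  rcases (hA.nonneg ha).eq_or_lt with hA0 | hA0
  · have h0 : a = 0 := (hasSum_zero_iff_of_nonneg ha).mp (hA0 ▸ hA)
    rw [← hA0, zero_mul]
    refine hD.nonneg fun i => ?_
    simp [h0]
  have hB0 : 0 < B := by
    obtain ⟨i, hi⟩ : ∃ i, 0 < a i := by
      by_contra! h
      exact hA0.not_ge (hA.nonpos h)
    exact (hab i hi).trans_le (le_hasSum hB i fun j _ => hb j)
  have hsum := ((hA.mul_right (Real.log (A / B))).add hA).sub (hB.mul_right (A / B))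
  have hle := hasSum_le (fun i => ?_) hsum hD
  · have h' : B * (A / B) = A := by field_simp
    linarith
  · rcases (ha i).eq_or_lt with hi | hi
    · rw [← hi]
      have := mul_nonneg (hb i) (div_pos hA0 hB0).le
      simpa using this
    · have hbi := hab i hi
      have hc : 0 < b i * (A / B) := mul_pos hbi (div_pos hA0 hB0)
      have h := sub_le_mul_log_div hi.le hc.le fun _ => hc
      rw [← div_div, Real.log_div (div_pos hi hbi).ne' (div_pos hA0 hB0).ne', mul_sub] at h
      linarith

theorem pr_nonneg {A : Type*} (p : PMF A) (y : A) : 0 ≤ pr p y := ENNReal.toReal_nonneg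

theorem hasSum_pr {A : Type*} (p : PMF A) : HasSum (pr p) 1 := by
  have h := ENNReal.hasSum_toReal (f := p) p.tsum_coe_ne_top
  rwa [← ENNReal.tsum_toReal_eq p.apply_ne_top, p.tsum_coe, ENNReal.toReal_one] at h

theorem hasSum_prefixProb {σ : Type*} (p : PMF (List σ)) (x : List σ) :
    HasSum (fun z => pr p (x ++ z)) (prefixProb p x) :=
  (summable_append (hasSum_pr p).summable x).hasSum

theorem prefixProb_nonneg {σ : Type*} (p : PMF (List σ)) (x : List σ) : 0 ≤ prefixProb p x :=
  tsum_nonneg fun _ => pr_nonneg _ _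

theorem prefixProb_nil {σ : Type*} (p : PMF (List σ)) : prefixProb p [] = 1 :=
  (hasSum_pr p).tsum_eq

theorem prefixProb_pos {σ : Type*} {p q : PMF (List σ)} (hsupp : ∀ y, 0 < pr p y → 0 < pr q y)
    {x : List σ} (hx : 0 < prefixProb p x) : 0 < prefixProb q x := by
  obtain ⟨z, hz⟩ : ∃ z, 0 < pr p (x ++ z) := by
    by_contra! h
    exact hx.not_ge ((hasSum_prefixProb p x).nonpos h)
  exact (hsupp _ hz).trans_le (le_hasSum (hasSum_prefixProb q x) z fun _ _ => pr_nonneg _ _)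

/-- The joint mass of the prefix `x` and the next symbol. -/
noncomputable def jointProb {σ : Type*} (p : PMF (List σ)) (x : List σ) : Option σ → ℝ
  | some a => prefixProb p (x ++ [a])
  | none => pr p x

theorem jointProb_nonneg {σ : Type*} (p : PMF (List σ)) (x : List σ) (o : Option σ) :
    0 ≤ jointProb p x o := by
  cases o
  · exact pr_nonneg _ _
  · exact prefixProb_nonneg _ _

theorem jointProb_pos {σ : Type*} {p q : PMF (List σ)} (hsupp : ∀ y, 0 < pr p y → 0 < pr q y)
    (x : List σ) (o : Option σ) (h : 0 < jointProb p x o) : 0 < jointProb q x o := by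
  cases o
  · exact hsupp _ h
  · exact prefixProb_pos hsupp h

theorem condProb_eq_div {σ : Type*} (p : PMF (List σ)) (x : List σ) (o : Option σ) :
    condProb p x o = jointProb p x o / prefixProb p x := by
  cases o <;> rfl

theorem sum_jointProb {σ : Type*} [Fintype σ] (p : PMF (List σ)) (x : List σ) :
    ∑ o, jointProb p x o = prefixProb p x := by
  rw [Fintype.sum_option]
  exact (tailSum_eq_add_sum (hasSum_pr p).summable x).symm

theorem prefixProb_mul_localKL {σ : Type*} [Fintype σ] {p q : PMF (List σ)}
    (hsupp : ∀ y, 0 < pr p y → 0 < pr q y) (x : List σ) :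
    prefixProb p x * localKL p q x =
      ∑ o, jointProb p x o * Real.log (jointProb p x o / jointProb q x o) -
        prefixProb p x * Real.log (prefixProb p x / prefixProb q x) := by
  rcases (prefixProb_nonneg p x).eq_or_lt with hP | hP
  · have h0 : ∀ o, jointProb p x o = 0 := fun o =>
      (Finset.sum_eq_zero_iff_of_nonneg fun o _ => jointProb_nonneg p x o).mp
        ((sum_jointProb p x).trans hP.symm) o (Finset.mem_univ o)
    simp [← hP, h0]
  have hQ := prefixProb_pos hsupp hP
  nth_rewrite 2 [← sum_jointProb p x]
  rw [localKL, Finset.mul_sum, Finset.sum_mul, ← Finset.sum_sub_distrib]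
  refine Finset.sum_congr rfl fun o _ => ?_
  rw [condProb_eq_div, condProb_eq_div]
  rcases (jointProb_nonneg p x o).eq_or_lt with ho | ho
  · simp [← ho]
  have hoq := jointProb_pos hsupp x o ho
  rw [div_div_div_comm, Real.log_div (div_pos ho hoq).ne' (div_pos hP hQ).ne', ← mul_assoc,
    mul_div_cancel₀ _ hP.ne', mul_sub]

/-- **Prefix decomposition of the KL divergence** (Theorem of
Malagutti et al. 2024, as used in the paper).  Let `p, q` be language models over a
finite alphabet `Σ` with `q(y) > 0` whenever `p(y) > 0`, and assume `KL(p‖q) < ∞`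
(the defining series converges).  Then each term `π_p(x)·KL(p̄(·|x)‖q̄(·|x))` is
nonnegative (terms with `π_p(x) = 0` contribute `0`), the family is summable, and
`KL(p‖q) = ∑_{x ∈ Σ*} π_p(x)·KL(p̄(·|x)‖q̄(·|x))`. -/
theorem kl_prefix_decomposition {σ : Type*} [Fintype σ] [Nonempty σ]
    (p q : PMF (List σ))
    (hsupp : ∀ y, 0 < pr p y → 0 < pr q y)
    (hKL : Summable fun y : List σ => pr p y * Real.log (pr p y / pr q y)) :
    (∀ x : List σ, 0 ≤ prefixProb p x * localKL p q x) ∧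
    Summable (fun x : List σ => prefixProb p x * localKL p q x) ∧
    KLdiv p q = ∑' x : List σ, prefixProb p x * localKL p q x := by
  have hL : ∀ x : List σ, 0 ≤ prefixProb p x * localKL p q x := fun x => by
    rw [prefixProb_mul_localKL hsupp, sub_nonneg]
    refine mul_log_div_le_of_hasSum (jointProb_nonneg p x) (jointProb_nonneg q x)
      (jointProb_pos hsupp x) ?_ ?_ (hasSum_fintype _)
    · exact sum_jointProb p x ▸ hasSum_fintype _
    · exact sum_jointProb q x ▸ hasSum_fintype _
  set d : List σ → ℝ := fun y => pr p y * Real.log (pr p y / pr q y) with hd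
  set G : List σ → ℝ := fun x => prefixProb p x * Real.log (prefixProb p x / prefixProb q x)
    with hG
  have htail : ∀ x, HasSum (fun z => d (x ++ z)) (tailSum d x) := fun x =>
    (summable_append hKL x).hasSum
  have key : HasSum (fun x => prefixProb p x * localKL p q x) (tailSum d [] - G []) := by
    refine hasSum_of_le_tailSum (E := fun x => tailSum d x - G x)
      (f := fun y => d y - (pr p y - pr q y)) hL (fun x => ?_)
      (hKL.sub ((hasSum_pr p).summable.sub (hasSum_pr q).summable)) (fun x => ?_) fun x => ?_
    · exact sub_nonneg.mpr (mul_log_div_le_of_hasSum (fun _ => pr_nonneg _ _)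
        (fun _ => pr_nonneg _ _) (fun _ => hsupp _) (hasSum_prefixProb p x)
        (hasSum_prefixProb q x) (htail x))
    · have h : tailSum (fun y => d y - (pr p y - pr q y)) x =
          tailSum d x - (prefixProb p x - prefixProb q x) :=
        ((htail x).sub ((hasSum_prefixProb p x).sub (hasSum_prefixProb q x))).tsum_eq
      rw [h]
      exact sub_le_sub_left (sub_le_mul_log_div (prefixProb_nonneg p x) (prefixProb_nonneg q x)
        (prefixProb_pos hsupp)) _
    · rw [prefixProb_mul_localKL hsupp, Fintype.sum_option, tailSum_eq_add_sum hKL,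
        Finset.sum_sub_distrib]
      simp only [jointProb, hd, hG]
      ring
  refine ⟨hL, key.summable, ?_⟩
  rw [key.tsum_eq]
  simp [hG, prefixProb_nil, tailSum, KLdiv, hd]
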